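/- Every operator in the Hecke von Neumann algebra that commutes with h already lies in the double centralizer of {h}: one has {T ∈ M : T∘h = h∘T} = C(C({h})), the double centralizer of the singleton {h} in B(ℓ²(W)). Since C(C({h})) is automatically commutative, the radial algebra B = C(C({h})) is a maximal abelian von Neumann subalgebra (masa) of M = VN_q(W). -/

import Mathlib

noncomputable section

open scoped ComplexInnerProductSpace

namespace UCoxMasa

/-- The universal Coxeter matrix on `Fin L`: all off-diagonal entries are `0` (representing ∞). -/
def Mat (L : ℕ) : CoxeterMatrix (Fin L) where
  M := fun i j => if i = j then 1 else 0
  isSymm := by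
    ext i j
    by_cases h : i = j <;> simp [Matrix.transpose, h, eq_comm]
  diagonal := fun i => by simp
  off_diagonal := fun i j h => by simp [h]

/-- The universal Coxeter group on `L` generators: free product of `L` copies of `ℤ/2ℤ`. -/
abbrev W (L : ℕ) : Type := (Mat L).Group

/-- The distinguished Coxeter system of `W L`. -/
def cs (L : ℕ) : CoxeterSystem (Mat L) (W L) := CoxeterMatrix.toCoxeterSystem (Mat L)

/-- The simple reflection associated to `i : Fin L`. -/
def σ {L : ℕ} (i : Fin L) : W L := (cs L).simple i

/-- Word length on `W L` with respect to the generating set of simple reflections. -/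
def len {L : ℕ} (w : W L) : ℕ := (cs L).length w

/-- The Hilbert space `ℓ²(W)`. -/
abbrev H (L : ℕ) : Type := lp (fun _ : W L => ℂ) 2

/-- The standard orthonormal basis vector `δ_w` of `ℓ²(W)`. -/
def δ {L : ℕ} (w : W L) : H L :=
  letI := Classical.decEq (W L)
  lp.single 2 w 1

/-- `V l`: the linear span of `{δ_w : ℓ(w) = l}`. -/
def V (L : ℕ) (l : ℕ) : Submodule ℂ (H L) :=
  Submodule.span ℂ {x : H L | ∃ w : W L, len w = l ∧ x = δ w}

/-- `S_l`: the linear span of `q_l(h V_{l-1}) ∪ q_l(R_h V_{l-1})`,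
given the projections `Q`, the operator `h` and the right operator `Rh`. -/
def Sl (L : ℕ) (Q : ℕ → (H L →L[ℂ] H L)) (h Rh : H L →L[ℂ] H L) (l : ℕ) :
    Submodule ℂ (H L) :=
  Submodule.span ℂ
    ({x : H L | ∃ y ∈ V L (l - 1), x = Q l (h y)} ∪
      {x : H L | ∃ y ∈ V L (l - 1), x = Q l (Rh y)})

end UCoxMasa

namespace UCoxMasa

variable {L : ℕ}

/-! ### Normal forms in the universal Coxeter group -/

/-- Left multiplication by the letter `s` on words without equal adjacent letters. -/
def letterMul (s : Fin L) : List (Fin L) → List (Fin L)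
  | [] => [s]
  | a :: l => if s = a then l else s :: a :: l

lemma letterMul_isChain (s : Fin L) {l : List (Fin L)} (hl : l.IsChain (· ≠ ·)) :
    (letterMul s l).IsChain (· ≠ ·) := by
  cases l with
  | nil => simp [letterMul]
  | cons a l =>
    simp only [letterMul]
    split_ifs with h
    · exact hl.tail
    · exact List.isChain_cons_cons.2 ⟨h, hl⟩

lemma letterMul_eq_cons {s : Fin L} {l : List (Fin L)} (h : (s :: l).IsChain (· ≠ ·)) :
    letterMul s l = s :: l := by
  cases l with
  | nil => rfl
  | cons a l => simp [letterMul, (List.isChain_cons_cons.1 h).1]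

lemma letterMul_letterMul (s : Fin L) {l : List (Fin L)} (hl : l.IsChain (· ≠ ·)) :
    letterMul s (letterMul s l) = l := by
  cases l with
  | nil => simp [letterMul]
  | cons a l =>
    by_cases h : s = a
    · subst h
      simpa [letterMul] using letterMul_eq_cons hl
    · simp [letterMul, h]

/-- Left multiplication by a letter, as a permutation of the reduced words. -/
def letterPerm (s : Fin L) : Equiv.Perm {l : List (Fin L) // l.IsChain (· ≠ ·)} where
  toFun l := ⟨letterMul s l.1, letterMul_isChain s l.2⟩
  invFun l := ⟨letterMul s l.1, letterMul_isChain s l.2⟩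
  left_inv l := Subtype.ext (letterMul_letterMul s l.2)
  right_inv l := Subtype.ext (letterMul_letterMul s l.2)

lemma letterPerm_isLiftable : (Mat L).IsLiftable (letterPerm (L := L)) := by
  intro i j
  by_cases h : i = j
  · subst h
    ext l
    simp [Mat, letterPerm, letterMul_letterMul _ l.2]
  · simp [Mat, h]

/-- The reduced expression of an element. -/
def word (w : W L) : List (Fin L) :=
  ((cs L).lift ⟨letterPerm, letterPerm_isLiftable⟩ w ⟨[], by simp⟩).1

lemma word_isChain (w : W L) : (word w).IsChain (· ≠ ·) := Subtype.property _

@[simp] lemma word_one : word (1 : W L) = [] := by simp [word]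

lemma word_σ_mul (s : Fin L) (w : W L) : word (σ s * w) = letterMul s (word w) := by
  have := (cs L).lift_apply_simple (letterPerm_isLiftable (L := L)) s
  simp only [word, map_mul, σ, this, Equiv.Perm.mul_apply]
  rfl

@[simp] lemma σ_mul_σ_mul (s : Fin L) (w : W L) : σ s * (σ s * w) = w :=
  (cs L).simple_mul_simple_cancel_left s

@[simp] lemma mul_σ_mul_σ (s : Fin L) (w : W L) : w * σ s * σ s = w :=
  (cs L).simple_mul_simple_cancel_right s

@[simp] lemma inv_σ (s : Fin L) : (σ s)⁻¹ = σ s := (cs L).inv_simple s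

lemma wordProd_letterMul (s : Fin L) (l : List (Fin L)) :
    (cs L).wordProd (letterMul s l) = σ s * (cs L).wordProd l := by
  cases l with
  | nil => simp [letterMul, σ]
  | cons a l =>
    simp only [letterMul]
    split_ifs with h
    · subst h
      rw [CoxeterSystem.wordProd_cons]
      exact (σ_mul_σ_mul s _).symm
    · rw [CoxeterSystem.wordProd_cons]
      rfl

@[simp] lemma wordProd_word (w : W L) : (cs L).wordProd (word w) = w := by
  refine (cs L).simple_induction_left (p := fun w => (cs L).wordProd (word w) = w) w (by simp)
    fun w i ih => ?_
  have := word_σ_mul i w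
  rw [σ] at this
  rw [this, wordProd_letterMul, ih, σ]

lemma word_injective : Function.Injective (word (L := L)) :=
  Function.LeftInverse.injective wordProd_word

lemma word_wordProd {l : List (Fin L)} (hl : l.IsChain (· ≠ ·)) :
    word ((cs L).wordProd l) = l := by
  induction l with
  | nil => simp
  | cons a l ih =>
    rw [CoxeterSystem.wordProd_cons, show (cs L).simple a = σ a from rfl, word_σ_mul, ih hl.tail,
      letterMul_eq_cons hl]

lemma length_word_wordProd_le (l : List (Fin L)) :
    (word ((cs L).wordProd l)).length ≤ l.length := by
  induction l with
  | nil => simp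
  | cons a l ih =>
    rw [CoxeterSystem.wordProd_cons, show (cs L).simple a = σ a from rfl, word_σ_mul]
    rcases hw : word ((cs L).wordProd l) with _ | ⟨b, m⟩
    · simp [letterMul]
    · rw [hw] at ih
      simp only [letterMul, List.length_cons] at ih ⊢
      split_ifs <;> grind

lemma length_word (w : W L) : (word w).length = len w := by
  apply le_antisymm
  · obtain ⟨l, hl, rfl⟩ := (cs L).exists_isReduced w
    exact (length_word_wordProd_le l).trans hl.symm.le
  · conv_lhs => rw [← wordProd_word w]
    exact (cs L).length_wordProd_le _

lemma word_inv (w : W L) : word w⁻¹ = (word w).reverse := by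
  conv_lhs => rw [← wordProd_word w, ← CoxeterSystem.wordProd_reverse]
  refine word_wordProd (List.isChain_reverse.2 ?_)
  exact (word_isChain w).imp fun _ _ h => Ne.symm h

@[simp] lemma len_inv (w : W L) : len w⁻¹ = len w := (cs L).length_inv w

@[simp] lemma len_one : len (1 : W L) = 0 := (cs L).length_one

@[simp] lemma len_eq_zero {w : W L} : len w = 0 ↔ w = 1 := (cs L).length_eq_zero_iff

lemma word_eq_nil {w : W L} : word w = [] ↔ w = 1 := by
  rw [← List.length_eq_zero_iff, length_word, len_eq_zero]

/-! ### Descents -/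

/-- `s` is a left descent of `w`. -/
def LD (s : Fin L) (w : W L) : Prop := len (σ s * w) < len w

/-- `s` is a right descent of `w`. -/
def RD (s : Fin L) (w : W L) : Prop := len (w * σ s) < len w

instance (s : Fin L) (w : W L) : Decidable (LD s w) := Nat.decLt _ _

instance (s : Fin L) (w : W L) : Decidable (RD s w) := Nat.decLt _ _

lemma RD_iff_LD_inv {s : Fin L} {w : W L} : RD s w ↔ LD s w⁻¹ := by
  rw [RD, LD, len_inv, ← len_inv (w * σ s), mul_inv_rev, inv_σ]

lemma LD_iff_RD_inv {s : Fin L} {w : W L} : LD s w ↔ RD s w⁻¹ := by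
  rw [RD_iff_LD_inv, inv_inv]

lemma LD_iff {s : Fin L} {w : W L} : LD s w ↔ (word w).head? = some s := by
  rw [LD, ← length_word, ← length_word, word_σ_mul]
  rcases word w with _ | ⟨a, l⟩
  · simp
  · simp only [letterMul]
    split_ifs with h
    · simp [h]
    · simp [Ne.symm h]

lemma RD_iff {s : Fin L} {w : W L} : RD s w ↔ (word w).getLast? = some s := by
  rw [RD_iff_LD_inv, LD_iff, word_inv, List.head?_reverse]

lemma word_σ_mul_of_not_LD {s : Fin L} {w : W L} (h : ¬ LD s w) :
    word (σ s * w) = s :: word w := by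
  rw [word_σ_mul]
  rw [LD_iff] at h
  rcases hw : word w with _ | ⟨a, l⟩
  · rfl
  · simp only [letterMul]
    rw [if_neg]
    rintro rfl
    simp [hw] at h

lemma LD_σ_mul_of_not_LD {s : Fin L} {w : W L} (h : ¬ LD s w) : LD s (σ s * w) := by
  rw [LD_iff, word_σ_mul_of_not_LD h, List.head?_cons]

lemma LD_σ_mul_iff_of_not_LD {s t : Fin L} {w : W L} (h : ¬ LD s w) :
    LD t (σ s * w) ↔ s = t := by
  rw [LD_iff, word_σ_mul_of_not_LD h, List.head?_cons, Option.some_inj]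

lemma len_σ_mul_of_not_LD {s : Fin L} {w : W L} (h : ¬ LD s w) :
    len (σ s * w) = len w + 1 := by
  rw [← length_word, word_σ_mul_of_not_LD h, List.length_cons, length_word]

lemma not_LD_σ_mul_of_LD {s : Fin L} {w : W L} (h : LD s w) : ¬ LD s (σ s * w) := by
  rw [LD] at *
  rw [σ_mul_σ_mul]
  omega

lemma len_σ_mul_of_LD {s : Fin L} {w : W L} (h : LD s w) : len (σ s * w) + 1 = len w := by
  simpa using (len_σ_mul_of_not_LD (not_LD_σ_mul_of_LD h)).symm

lemma not_LD_one (s : Fin L) : ¬ LD s (1 : W L) := by simp [LD]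

lemma σ_mul_ne_one_of_not_LD {s : Fin L} {w : W L} (h : ¬ LD s w) : σ s * w ≠ 1 := by
  rw [Ne, ← len_eq_zero.not, len_σ_mul_of_not_LD h]
  omega

lemma exists_LD {w : W L} (hw : w ≠ 1) : ∃ s, LD s w ∧ ∀ t, LD t w ↔ t = s := by
  rcases h : word w with _ | ⟨s, l⟩
  · exact absurd (word_eq_nil.1 h) hw
  · refine ⟨s, by simp [LD_iff, h], fun t => by simp [LD_iff, h, eq_comm]⟩

lemma RD_σ_mul_iff {s t : Fin L} {w : W L} (hw : w ≠ 1) (h : ¬ LD s w) :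
    RD t (σ s * w) ↔ RD t w := by
  rw [RD_iff, RD_iff, word_σ_mul_of_not_LD h]
  rcases h' : word w with _ | ⟨a, l⟩
  · exact absurd (word_eq_nil.1 h') hw
  · rw [List.getLast?_cons_cons]

lemma LD_mul_σ_iff {s t : Fin L} {w : W L} (hw : w ≠ 1) (h : ¬ RD t w) :
    LD s (w * σ t) ↔ LD s w := by
  rw [LD_iff_RD_inv, LD_iff_RD_inv, mul_inv_rev, inv_σ]
  exact RD_σ_mul_iff (inv_ne_one.2 hw) (by rwa [← RD_iff_LD_inv])

lemma σ_mul_eq_mul_σ_of_LD_mul {s t : Fin L} {w : W L} (h : ¬ LD s w) (h' : LD s (w * σ t)) :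
    σ s * w = w * σ t := by
  by_cases hw : w = 1
  · subst hw
    have := not_LD_one t
    have h2 := (LD_σ_mul_iff_of_not_LD (t := s) this).1 (by simpa using h')
    simp [h2]
  · by_cases hr : RD t w
    · have h1 : RD t (σ s * w) := (RD_σ_mul_iff hw h).2 hr
      have h2 := len_σ_mul_of_not_LD h
      have h3 := len_σ_mul_of_LD h'
      rw [RD] at hr h1
      have h4 := (cs L).length_mul_simple (σ s * w) t
      have h5 := (cs L).length_mul_simple w t
      change len (σ s * w * σ t) = len (σ s * w) + 1 ∨ len (σ s * w * σ t) + 1 = len (σ s * w) at h4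
      change len (w * σ t) = len w + 1 ∨ len (w * σ t) + 1 = len w at h5
      rw [mul_assoc] at h1 h4
      omega
    · exact absurd ((LD_mul_σ_iff hw hr).1 h') h

/-- A left descent is unaffected by right multiplication with a letter, except when left and right
multiplication agree. -/
lemma LD_mul_σ_iff_or_eq (s t : Fin L) (w : W L) :
    (LD s (w * σ t) ↔ LD s w) ∨ σ s * w = w * σ t := by
  by_cases h : LD s w <;> by_cases h' : LD s (w * σ t)
  · simp [h, h']
  · right
    have := σ_mul_eq_mul_σ_of_LD_mul h' (t := t) (by simpa using h)
    rw [mul_σ_mul_σ, ← mul_assoc] at this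
    have h2 := congrArg (· * σ t) this
    simpa using h2
  · exact Or.inr (σ_mul_eq_mul_σ_of_LD_mul h h')
  · simp [h, h']

lemma RD_σ_mul_iff_or_eq (s t : Fin L) (w : W L) :
    (RD t (σ s * w) ↔ RD t w) ∨ σ s * w = w * σ t := by
  rcases LD_mul_σ_iff_or_eq t s w⁻¹ with h | h
  · left
    rw [RD_iff_LD_inv, RD_iff_LD_inv, mul_inv_rev, inv_σ, h]
  · right
    have := congrArg (·⁻¹) h
    simpa using this.symm

/-! ### Neighbour sums -/

/-- Sum over the left neighbours of `w` that are farther from `1`. -/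
def up {E : Type*} [AddCommMonoid E] (f : W L → E) (w : W L) : E :=
  ∑ s with ¬ LD s w, f (σ s * w)

/-- Sum over the left neighbours of `w` that are closer to `1`. -/
def down {E : Type*} [AddCommMonoid E] (f : W L → E) (w : W L) : E :=
  ∑ s with LD s w, f (σ s * w)

/-- Sum over the right neighbours of `w` that are farther from `1`. -/
def upR {E : Type*} [AddCommMonoid E] (f : W L → E) (w : W L) : E :=
  ∑ s with ¬ RD s w, f (w * σ s)

/-- Sum over the right neighbours of `w` that are closer to `1`. -/
def downR {E : Type*} [AddCommMonoid E] (f : W L → E) (w : W L) : E :=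
  ∑ s with RD s w, f (w * σ s)

section AddCommMonoid

variable {E : Type*} [AddCommMonoid E]

lemma down_add_up (f : W L → E) (w : W L) : down f w + up f w = ∑ s, f (σ s * w) :=
  Finset.sum_filter_add_sum_filter_not _ _ _

lemma downR_add_upR (f : W L → E) (w : W L) : downR f w + upR f w = ∑ s, f (w * σ s) :=
  Finset.sum_filter_add_sum_filter_not _ _ _

lemma upR_eq (f : W L → E) (w : W L) : upR f w = up (fun v => f v⁻¹) w⁻¹ := by
  simp [upR, up, RD_iff_LD_inv, mul_inv_rev]

lemma downR_eq (f : W L → E) (w : W L) : downR f w = down (fun v => f v⁻¹) w⁻¹ := by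
  simp [downR, down, RD_iff_LD_inv, mul_inv_rev]

lemma filter_LD {w : W L} (hw : w ≠ 1) : ∃ s, LD s w ∧ ({t | LD t w} : Finset (Fin L)) = {s} := by
  obtain ⟨s, hs, h⟩ := exists_LD hw
  exact ⟨s, hs, by ext t; simp [h]⟩

lemma card_filter_not_LD {w : W L} (hw : w ≠ 1) :
    ({t | ¬ LD t w} : Finset (Fin L)).card = L - 1 := by
  obtain ⟨s, -, h⟩ := filter_LD hw
  have := Finset.card_filter_add_card_filter_not (s := (Finset.univ : Finset (Fin L)))
    (fun t => LD t w)
  rw [h] at this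
  simp at this
  omega

lemma sum_ite_LD (c : E) {w : W L} (hw : w ≠ 1) :
    ∑ s, (if LD s w then c else 0) = c := by
  obtain ⟨s, hs, h⟩ := exists_LD hw
  rw [Finset.sum_eq_single s (fun t _ ht => if_neg (by rwa [h])) (by simp), if_pos hs]

lemma down_wordProd (f : W L → E) {a : Fin L} {l : List (Fin L)}
    (hl : (a :: l).IsChain (· ≠ ·)) :
    down f ((cs L).wordProd (a :: l)) = f ((cs L).wordProd l) := by
  have h : ∀ t, LD t ((cs L).wordProd (a :: l)) ↔ t = a := fun t => by
    rw [LD_iff, word_wordProd hl, List.head?_cons, Option.some_inj, eq_comm]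
  simp only [down, h, Finset.filter_eq', Finset.mem_univ, if_true, Finset.sum_singleton]
  rw [CoxeterSystem.wordProd_cons]
  exact congrArg f (σ_mul_σ_mul a _)

lemma up_congr {f g : W L → E} (h : ∀ w, w ≠ 1 → f w = g w) (w : W L) : up f w = up g w :=
  Finset.sum_congr rfl fun _ hs => h _ (σ_mul_ne_one_of_not_LD (Finset.mem_filter.1 hs).2)

lemma upR_congr {f g : W L → E} (h : ∀ w, w ≠ 1 → f w = g w) (w : W L) : upR f w = upR g w := by
  rw [upR_eq, upR_eq]
  exact up_congr (fun w hw => h _ (inv_ne_one.2 hw)) _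

lemma up_down (f : W L → E) {w : W L} (hw : w ≠ 1) : up (down f) w = (L - 1) • f w := by
  rw [← card_filter_not_LD hw, ← Finset.sum_const]
  refine Finset.sum_congr rfl fun s hs => ?_
  have hs := (Finset.mem_filter.1 hs).2
  have h : ∀ t, LD t (σ s * w) ↔ t = s := fun t => by
    rw [LD_σ_mul_iff_of_not_LD hs, eq_comm]
  simp [down, h, Finset.filter_eq']

lemma upR_downR (f : W L → E) {w : W L} (hw : w ≠ 1) : upR (downR f) w = (L - 1) • f w := by
  have := up_down (fun v => f v⁻¹) (inv_ne_one.2 hw)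
  rw [upR_eq]
  simpa [downR_eq] using this

lemma up_upR (f : W L → E) {w : W L} (hw : w ≠ 1) : up (upR f) w = upR (up f) w := by
  have h1 : up (upR f) w = ∑ s with ¬ LD s w, ∑ t with ¬ RD t w, f (σ s * w * σ t) := by
    refine Finset.sum_congr rfl fun s hs => Finset.sum_congr ?_ fun _ _ => rfl
    ext t
    simp [RD_σ_mul_iff hw (Finset.mem_filter.1 hs).2]
  have h2 : upR (up f) w = ∑ t with ¬ RD t w, ∑ s with ¬ LD s w, f (σ s * (w * σ t)) := by
    refine Finset.sum_congr rfl fun s hs => Finset.sum_congr ?_ fun _ _ => rfl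
    ext t
    simp [LD_mul_σ_iff hw (Finset.mem_filter.1 hs).2]
  rw [h1, h2, Finset.sum_comm]
  simp only [mul_assoc]

lemma up_smul (n : ℕ) (f : W L → E) (w : W L) : up (fun v => n • f v) w = n • up f w :=
  (Finset.smul_sum).symm

lemma upR_smul (n : ℕ) (f : W L → E) (w : W L) : upR (fun v => n • f v) w = n • upR f w :=
  (Finset.smul_sum).symm

end AddCommMonoid

lemma up_sub {E : Type*} [AddCommGroup E] (f g : W L → E) (w : W L) :
    up (fun v => f v - g v) w = up f w - up g w := Finset.sum_sub_distrib _ _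

lemma upR_sub {E : Type*} [AddCommGroup E] (f g : W L → E) (w : W L) :
    upR (fun v => f v - g v) w = upR f w - upR g w := Finset.sum_sub_distrib _ _

/-- If left and right neighbour sums of `f` agree, then `up f - upR f` is an eigenfunction of
`up ∘ upR` away from the identity. -/
lemma up_upR_up_sub_upR {E : Type*} [AddCommGroup E] {f : W L → E}
    (hf : ∀ w, down f w + up f w = downR f w + upR f w) {w : W L} (hw : w ≠ 1) :
    up (upR fun v => up f v - upR f v) w = (L - 1) • (up f w - upR f w) := by
  have h : (fun v => up f v - upR f v) = fun v => downR f v - down f v := by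
    funext v
    have := hf v
    rw [sub_eq_sub_iff_add_eq_add, add_comm, this]
  have h1 : upR (fun v => downR f v - down f v) = fun v => upR (downR f) v - upR (down f) v :=
    funext fun v => upR_sub _ _ v
  rw [h, h1, up_sub, up_congr (fun v hv => upR_downR f hv), up_smul, up_upR _ hw,
    upR_congr (fun v hv => up_down f hv), upR_smul, smul_sub]

lemma sq_norm_up_le {E : Type*} [SeminormedAddCommGroup E] (f : W L → E) {w : W L} (hw : w ≠ 1) :
    ‖up f w‖ ^ 2 ≤ (L - 1 : ℕ) * up (fun v => ‖f v‖ ^ 2) w := by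
  rw [← card_filter_not_LD hw]
  calc ‖up f w‖ ^ 2 ≤ (∑ s with ¬ LD s w, ‖f (σ s * w)‖) ^ 2 := by
        gcongr; exact norm_sum_le _ _
    _ ≤ _ := sq_sum_le_card_mul_sum_sq

lemma sq_norm_upR_le {E : Type*} [SeminormedAddCommGroup E] (f : W L → E) {w : W L}
    (hw : w ≠ 1) : ‖upR f w‖ ^ 2 ≤ (L - 1 : ℕ) * upR (fun v => ‖f v‖ ^ 2) w := by
  rw [upR_eq, upR_eq]
  exact sq_norm_up_le _ (inv_ne_one.2 hw)

lemma up_mono {f g : W L → ℝ} (h : ∀ w, w ≠ 1 → f w ≤ g w) (w : W L) : up f w ≤ up g w :=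
  Finset.sum_le_sum fun _ hs => h _ (σ_mul_ne_one_of_not_LD (Finset.mem_filter.1 hs).2)

/-! ### Spheres -/

lemma sphere_finite (n : ℕ) : {w : W L | len w = n}.Finite := by
  refine Set.Finite.of_finite_image (f := word) ?_ word_injective.injOn
  refine (List.finite_length_eq (Fin L) n).subset ?_
  rintro _ ⟨w, hw, rfl⟩
  exact (length_word w).trans hw

/-- The elements of length `n`. -/
def sphere (L n : ℕ) : Finset (W L) := (sphere_finite n).toFinset

@[simp] lemma mem_sphere {n : ℕ} {w : W L} : w ∈ sphere L n ↔ len w = n := by simp [sphere]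

lemma ne_one_of_mem_sphere {n : ℕ} {w : W L} (hw : w ∈ sphere L (n + 1)) : w ≠ 1 := by
  rintro rfl
  simp at hw

lemma sum_sphere_inv {E : Type*} [AddCommMonoid E] (n : ℕ) (f : W L → E) :
    ∑ w ∈ sphere L n, f w⁻¹ = ∑ w ∈ sphere L n, f w :=
  Finset.sum_nbij' (·⁻¹) (·⁻¹) (by simp) (by simp) (by simp) (by simp) (by simp)

lemma sum_sphere_up {E : Type*} [AddCommMonoid E] (n : ℕ) (f : W L → E) :
    ∑ w ∈ sphere L n, up f w = ∑ w ∈ sphere L (n + 1), f w := by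
  have h : ∀ w ∈ sphere L (n + 1), f w = ∑ s with LD s w, f w := fun w hw => by
    obtain ⟨s, -, hs⟩ := filter_LD (ne_one_of_mem_sphere hw)
    rw [hs, Finset.sum_singleton]
  rw [Finset.sum_congr rfl h]
  simp only [up]
  rw [Finset.sum_sigma', Finset.sum_sigma']
  refine Finset.sum_nbij' (fun x => ⟨σ x.2 * x.1, x.2⟩) (fun x => ⟨σ x.2 * x.1, x.2⟩)
    ?_ ?_ ?_ ?_ ?_
  · rintro ⟨w, s⟩ hx
    simp only [Finset.mem_sigma, mem_sphere, Finset.mem_filter, Finset.mem_univ, true_and] at hx ⊢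
    exact ⟨by rw [len_σ_mul_of_not_LD hx.2, hx.1], LD_σ_mul_of_not_LD hx.2⟩
  · rintro ⟨w, s⟩ hx
    simp only [Finset.mem_sigma, mem_sphere, Finset.mem_filter, Finset.mem_univ, true_and] at hx ⊢
    have := len_σ_mul_of_LD hx.2
    exact ⟨by omega, not_LD_σ_mul_of_LD hx.2⟩
  · simp
  · simp
  · simp

lemma sum_sphere_upR {E : Type*} [AddCommMonoid E] (n : ℕ) (f : W L → E) :
    ∑ w ∈ sphere L n, upR f w = ∑ w ∈ sphere L (n + 1), f w := by
  rw [← sum_sphere_inv (n + 1), ← sum_sphere_up, ← sum_sphere_inv n]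
  simp [upR_eq]

lemma hasSum_sum_sphere {E : Type*} [AddCommMonoid E] [TopologicalSpace E] [ContinuousAdd E]
    [RegularSpace E] {f : W L → E} {a : E} (hf : HasSum f a) :
    HasSum (fun n => ∑ w ∈ sphere L n, f w) a := by
  have h := ((Equiv.sigmaFiberEquiv (len (L := L))).hasSum_iff.2 hf)
  refine h.sigma fun n => ?_
  have h2 := (sphere L n).hasSum f
  refine (Equiv.hasSum_iff (f := fun w : {w // w ∈ sphere L n} => f w)
    (Equiv.subtypeEquivRight fun w => (mem_sphere (n := n) (w := w)).symm)).2 h2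

/-! ### Square-summable functions with equal left and right neighbour sums -/

lemma up_eq_upR {f : W L → ℂ} (hf : ∀ w, down f w + up f w = downR f w + upR f w)
    (hL : 2 ≤ L) (hs : Summable fun w => ‖f w‖ ^ 2) {w : W L} (hw : w ≠ 1) :
    up f w = upR f w := by
  set g : W L → ℂ := fun v => up f v - upR f v with hg
  set k : ℝ := ((L - 1 : ℕ) : ℝ) with hk
  have hk0 : 0 < k := by rw [hk]; exact_mod_cast (by omega : 0 < L - 1)
  have hle : ∀ v : W L, v ≠ 1 → ‖g v‖ ^ 2 ≤ up (upR fun u => ‖g u‖ ^ 2) v := by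
    intro v hv
    have h1 : k ^ 2 * ‖g v‖ ^ 2 = ‖up (upR g) v‖ ^ 2 := by
      rw [up_upR_up_sub_upR hf hv, nsmul_eq_mul, norm_mul, mul_pow]
      simp [hk, hg]
    have h2 := sq_norm_up_le (upR g) hv
    have h3 := up_mono (fun u hu => sq_norm_upR_le g hu) v
    have h4 : up (fun u => k * upR (fun v => ‖g v‖ ^ 2) u) v =
        k * up (upR fun v => ‖g v‖ ^ 2) v := (Finset.mul_sum _ _ _).symm
    rw [h4] at h3
    have : k ^ 2 * ‖g v‖ ^ 2 ≤ k ^ 2 * up (upR fun v => ‖g v‖ ^ 2) v := by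
      rw [h1, sq k, mul_assoc]
      exact h2.trans (mul_le_mul_of_nonneg_left h3 hk0.le)
    exact le_of_mul_le_mul_left this (by positivity)
  set N : ℕ → ℝ := fun n => ∑ v ∈ sphere L n, ‖g v‖ ^ 2 with hN
  have hstep : ∀ n, N (n + 1) ≤ N (n + 3) := fun n => by
    simp only [hN]
    rw [← sum_sphere_upR (n + 2), ← sum_sphere_up (n + 1)]
    exact Finset.sum_le_sum fun v hv => hle v (ne_one_of_mem_sphere hv)
  have hbound : ∀ n, N (n + 1) ≤ 4 * k * ∑ v ∈ sphere L (n + 2), ‖f v‖ ^ 2 := fun n => by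
    calc N (n + 1) ≤ ∑ v ∈ sphere L (n + 1), (2 * k * up (fun u => ‖f u‖ ^ 2) v +
          2 * k * upR (fun u => ‖f u‖ ^ 2) v) := by
          refine Finset.sum_le_sum fun v hv => ?_
          have h1 := sq_norm_up_le f (ne_one_of_mem_sphere hv)
          have h2 := sq_norm_upR_le f (ne_one_of_mem_sphere hv)
          have h3 : ‖g v‖ ^ 2 ≤ (‖up f v‖ + ‖upR f v‖) ^ 2 := by
            gcongr; exact norm_sub_le _ _
          nlinarith [sq_nonneg (‖up f v‖ - ‖upR f v‖)]
      _ = _ := by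
          rw [Finset.sum_add_distrib, ← Finset.mul_sum, ← Finset.mul_sum, sum_sphere_up,
            sum_sphere_upR]
          ring
  have hlim : Filter.Tendsto (fun n => ∑ v ∈ sphere L n, ‖f v‖ ^ 2) Filter.atTop (nhds 0) :=
    (hasSum_sum_sphere hs.hasSum).summable.tendsto_atTop_zero
  have hle2 : ∀ n m, N (n + 1) ≤ N (n + 2 * m + 1) := fun n m => by
    induction m with
    | zero => rfl
    | succ m ih => exact ih.trans (hstep (n + 2 * m))
  have hzero : ∀ n, N (n + 1) ≤ 0 := fun n => by
    have h1 : Filter.Tendsto (fun m => 4 * k * ∑ v ∈ sphere L (n + 2 * m + 2), ‖f v‖ ^ 2)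
        Filter.atTop (nhds (4 * k * 0)) := by
      refine Filter.Tendsto.const_mul _ (hlim.comp (f := fun m => n + 2 * m + 2) ?_)
      exact Filter.tendsto_atTop_mono (fun m => by simp only [id]; omega) Filter.tendsto_id
    rw [mul_zero] at h1
    exact ge_of_tendsto' h1 fun m => (hle2 n m).trans (hbound (n + 2 * m))
  obtain ⟨n, hn⟩ : ∃ n, len w = n + 1 := Nat.exists_eq_succ_of_ne_zero (by simpa using hw)
  have h1 : ‖g w‖ ^ 2 ≤ N (n + 1) :=
    Finset.single_le_sum (f := fun v => ‖g v‖ ^ 2) (fun _ _ => sq_nonneg _) (by simp [hn])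
  have h2 : ‖g w‖ ^ 2 = 0 := le_antisymm (h1.trans (hzero n)) (sq_nonneg _)
  exact sub_eq_zero.1 (norm_eq_zero.1 (pow_eq_zero_iff two_ne_zero |>.1 h2))

lemma apply_wordProd_cons_eq_append {E : Type*} [AddCommMonoid E] {f : W L → E}
    (hf : ∀ w, w ≠ 1 → down f w = downR f w) {a c : Fin L} {l : List (Fin L)}
    (hl : (a :: l ++ [c]).IsChain (· ≠ ·)) :
    f ((cs L).wordProd (a :: l)) = f ((cs L).wordProd (l ++ [c])) := by
  set w := (cs L).wordProd (a :: l ++ [c]) with hw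
  have hw1 : w ≠ 1 := by
    rw [Ne, ← word_eq_nil, hw, word_wordProd hl]
    simp
  have h1 : down f w = f ((cs L).wordProd (l ++ [c])) := down_wordProd f hl
  have h2 : downR f w = f ((cs L).wordProd (a :: l)) := by
    rw [downR_eq, hw, ← CoxeterSystem.wordProd_reverse, List.reverse_append, List.reverse_singleton,
      List.singleton_append, down_wordProd, CoxeterSystem.wordProd_reverse, inv_inv]
    rw [← List.singleton_append, ← List.reverse_singleton, ← List.reverse_append]
    exact List.isChain_reverse.2 (hl.imp fun _ _ h => Ne.symm h)
  rw [← h1, ← h2, hf w hw1]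

lemma apply_wordProd_eq_drop {E : Type*} [AddCommMonoid E] {f : W L → E}
    (hf : ∀ w, w ≠ 1 → down f w = downR f w) (y : List (Fin L)) :
    ∀ x : List (Fin L), (x ++ y).IsChain (· ≠ ·) →
      f ((cs L).wordProd x) = f ((cs L).wordProd ((x ++ y).drop y.length)) := by
  induction y with
  | nil => simp
  | cons c y ih =>
    rintro (_ | ⟨a, l⟩) hx
    · simp
    · have h : a :: l ++ c :: y = (a :: l ++ [c]) ++ y := by simp
      rw [h] at hx
      rw [apply_wordProd_cons_eq_append hf hx.left_of_append, ih (l ++ [c]) (by simpa using hx.tail)]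
      simp

/-- A square-summable function whose left and right neighbour sums agree is radial. -/
theorem eq_of_len_eq {f : W L → ℂ} (hL : 3 ≤ L) (hf : ∀ w, ∑ s, f (σ s * w) = ∑ s, f (w * σ s))
    (hs : Summable fun w => ‖f w‖ ^ 2) {v w : W L} (h : len v = len w) : f v = f w := by
  have hf' : ∀ w, down f w + up f w = downR f w + upR f w := fun w => by
    rw [down_add_up, downR_add_upR, hf]
  have hd : ∀ w, w ≠ 1 → down f w = downR f w := fun w hw => by
    have := hf' w
    rwa [up_eq_upR hf' (by omega) hs hw, add_left_inj] at this
  obtain ⟨t, ht⟩ : ∃ t : Fin L, t ∉ ((word v).getLast?.toFinset ∪ (word w).head?.toFinset) := by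
    by_contra! hc
    have h1 := Finset.card_le_card (fun t _ => hc t : Finset.univ ⊆ _)
    have h2 := Finset.card_union_le (word v).getLast?.toFinset (word w).head?.toFinset
    have h3 : ∀ o : Option (Fin L), o.toFinset.card ≤ 1 := by rintro (_ | a) <;> simp
    have := h3 (word v).getLast?
    have := h3 (word w).head?
    simp only [Finset.card_univ, Fintype.card_fin] at h1
    omega
  simp only [Finset.mem_union, Option.mem_toFinset, not_or] at ht
  have hchain : (word v ++ t :: word w).IsChain (· ≠ ·) := by
    rw [List.isChain_append, List.isChain_cons]
    refine ⟨word_isChain v, ⟨?_, word_isChain w⟩, ?_⟩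
    · rintro y hy rfl
      exact ht.2 hy
    · rintro x hx y hy rfl
      simp only [List.head?_cons, Option.mem_def, Option.some_inj] at hy
      subst hy
      exact ht.1 hx
  have := apply_wordProd_eq_drop hd (t :: word w) (word v) hchain
  rw [List.length_cons, length_word, ← h, ← length_word, List.drop_append] at this
  simpa [List.drop_eq_nil_of_le] using this

/-! ### Operators on `ℓ²(W)` -/

open scoped Classical in
lemma δ_apply (v w : W L) : (δ v : H L) w = if w = v then 1 else 0 := by
  rw [δ, lp.single_apply, Pi.single_apply]

lemma inner_δ_left (w : W L) (x : H L) : ⟪δ w, x⟫ = x w := by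
  simp [δ, lp.inner_single_left]

lemma hasSum_δ (x : H L) : HasSum (fun w => x w • (δ w : H L)) x := by
  classical
  convert lp.hasSum_single (p := 2) (by simp) x using 2 with w
  rw [δ, ← lp.single_smul, smul_eq_mul, mul_one]

lemma clm_ext {E : Type*} [NormedAddCommGroup E] [NormedSpace ℂ E] {A B : H L →L[ℂ] E}
    (h : ∀ w, A (δ w) = B (δ w)) : A = B := by
  ext x
  have hA := (hasSum_δ x).mapL A
  have hB := (hasSum_δ x).mapL B
  simp only [map_smul, h] at hA hB
  exact hA.unique hB

/-- Evaluation at `w` as a continuous functional on `ℓ²(W)`. -/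
def evalL (w : W L) : H L →L[ℂ] ℂ := innerSL ℂ (δ w)

@[simp] lemma evalL_apply (w : W L) (x : H L) : evalL w x = x w := inner_δ_left w x

lemma orthonormal_δ_inv : Orthonormal ℂ fun w : W L => (δ w⁻¹ : H L) := by
  classical
  rw [orthonormal_iff_ite]
  intro v w
  rw [inner_δ_left, δ_apply]
  simp

/-- The unitary of `ℓ²(W)` induced by inversion in `W`. -/
lemma exists_flip : ∃ J : H L →L[ℂ] H L, ∀ w, J (δ w) = δ w⁻¹ := by
  classical
  let b : HilbertBasis (W L) ℂ (H L) := HilbertBasis.mkOfOrthogonalEqBot orthonormal_δ_inv (by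
    rw [Submodule.eq_bot_iff]
    intro x hx
    ext w
    have := hx (δ w) (Submodule.subset_span ⟨w⁻¹, by simp⟩)
    rw [inner_δ_left] at this
    simpa using this)
  refine ⟨(b.repr.symm : H L →L[ℂ] H L), fun w => ?_⟩
  have h1 : b w = δ w⁻¹ := by
    simp only [b, HilbertBasis.coe_mkOfOrthogonalEqBot]
  rw [← h1, ← b.repr_symm_single w]
  simp only [δ]
  congr!

/-- The defining relation of the Hecke operators `T_s`. -/
def IsHecke (p : ℝ) (T : Fin L → H L →L[ℂ] H L) : Prop :=
  ∀ s w, T s (δ w) = δ (σ s * w) + (if LD s w then (p : ℂ) else 0) • δ w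

/-- The defining relation of the right Hecke operators. -/
def IsRightHecke (p : ℝ) (R : Fin L → H L →L[ℂ] H L) : Prop :=
  ∀ s w, R s (δ w) = δ (w * σ s) + (if RD s w then (p : ℂ) else 0) • δ w

variable {p : ℝ} {T R : Fin L → H L →L[ℂ] H L}

lemma IsHecke.exists_isRightHecke (hT : IsHecke p T) :
    ∃ R : Fin L → H L →L[ℂ] H L, IsRightHecke p R := by
  obtain ⟨J, hJ⟩ := exists_flip (L := L)
  refine ⟨fun s => J * T s * J, fun s w => ?_⟩
  simp only [mul_apply_eq_comp, hJ, hT s w⁻¹, map_add, map_smul, mul_inv_rev, inv_inv,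
    inv_σ, RD_iff_LD_inv]

lemma IsHecke.commute (hT : IsHecke p T) (hR : IsRightHecke p R) (s t : Fin L) :
    T s * R t = R t * T s := by
  refine clm_ext fun w => ?_
  simp only [mul_apply_eq_comp, hT s, hR t, map_add, map_smul, mul_assoc]
  by_cases h : σ s * w = w * σ t
  · have h1 : LD s w ↔ RD t w := by rw [LD, RD, h]
    have h2 : LD s (w * σ t) ↔ RD t (σ s * w) := by
      rw [LD, RD, ← mul_assoc, h]
    simp only [h1, h2, h]
  · have h1 := (LD_mul_σ_iff_or_eq s t w).resolve_right h
    have h2 := (RD_σ_mul_iff_or_eq s t w).resolve_right h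
    simp only [h1, h2]
    module

lemma IsHecke.apply (hT : IsHecke p T) (s : Fin L) (x : H L) (w : W L) :
    T s x w = x (σ s * w) + (if LD s w then (p : ℂ) else 0) * x w := by
  classical
  have : evalL w ∘L T s =
      evalL (σ s * w) + (if LD s w then (p : ℂ) else 0) • evalL w := by
    refine clm_ext fun v => ?_
    have h1 : w = σ s * v ↔ σ s * w = v :=
      ⟨fun h => by rw [h, σ_mul_σ_mul], fun h => by rw [← h, σ_mul_σ_mul]⟩
    simp only [ContinuousLinearMap.comp_apply, hT s v, map_add, map_smul, evalL_apply, δ_apply,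
      add_apply, smul_apply, h1]
    congr 1
    by_cases h : w = v
    · simp [h]
    · simp [h]
  simpa only [ContinuousLinearMap.comp_apply, add_apply, smul_apply, evalL_apply, smul_eq_mul]
    using congrArg (fun A => A x) this

lemma IsRightHecke.apply (hR : IsRightHecke p R) (s : Fin L) (x : H L) (w : W L) :
    R s x w = x (w * σ s) + (if RD s w then (p : ℂ) else 0) * x w := by
  classical
  have : evalL w ∘L R s =
      evalL (w * σ s) + (if RD s w then (p : ℂ) else 0) • evalL w := by
    refine clm_ext fun v => ?_
    have h1 : w = v * σ s ↔ w * σ s = v :=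
      ⟨fun h => by rw [h, mul_σ_mul_σ], fun h => by rw [← h, mul_σ_mul_σ]⟩
    simp only [ContinuousLinearMap.comp_apply, hR s v, map_add, map_smul, evalL_apply, δ_apply,
      add_apply, smul_apply, h1]
    congr 1
    by_cases h : w = v
    · simp [h]
    · simp [h]
  simpa only [ContinuousLinearMap.comp_apply, add_apply, smul_apply, evalL_apply, smul_eq_mul]
    using congrArg (fun A => A x) this

lemma sum_apply_eq (A : Fin L → H L →L[ℂ] H L) (x : H L) (w : W L) :
    (∑ s, A s) x w = ∑ s, A s x w := by
  rw [← evalL_apply, _root_.sum_apply, map_sum]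
  simp

lemma IsHecke.sum_apply (hT : IsHecke p T) (x : H L) {w : W L} (hw : w ≠ 1) :
    (∑ s, T s) x w = ∑ s, x (σ s * w) + p * x w := by
  simp only [sum_apply_eq, hT.apply, Finset.sum_add_distrib, ← Finset.sum_mul, sum_ite_LD _ hw]

lemma IsHecke.sum_apply_one (hT : IsHecke p T) (x : H L) :
    (∑ s, T s) x 1 = ∑ s, x (σ s) := by
  simp only [sum_apply_eq, hT.apply, not_LD_one, if_false, zero_mul, add_zero, mul_one]

lemma IsRightHecke.sum_apply (hR : IsRightHecke p R) (x : H L) {w : W L} (hw : w ≠ 1) :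
    (∑ s, R s) x w = ∑ s, x (w * σ s) + p * x w := by
  simp only [sum_apply_eq, hR.apply, Finset.sum_add_distrib, ← Finset.sum_mul, RD_iff_LD_inv,
    sum_ite_LD _ (inv_ne_one.2 hw)]

lemma IsHecke.isSelfAdjoint (hT : IsHecke p T) (s : Fin L) : IsSelfAdjoint (T s) := by
  classical
  rw [ContinuousLinearMap.isSelfAdjoint_iff']
  refine clm_ext fun v => ?_
  ext w
  rw [← inner_δ_left, ContinuousLinearMap.adjoint_inner_right, ← inner_conj_symm, inner_δ_left,
    hT.apply, hT.apply, δ_apply, δ_apply, δ_apply, δ_apply]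
  have h1 : σ s * v = w ↔ σ s * w = v :=
    ⟨fun h => by rw [← h, σ_mul_σ_mul], fun h => by rw [← h, σ_mul_σ_mul]⟩
  by_cases h : v = w
  · subst h
    split_ifs <;> simp
  · simp [h1, h, Ne.symm h]

/-- An element of the Hecke von Neumann algebra which commutes with `h` acts on `δ 1` by a radial
vector. -/
lemma IsHecke.radial (hT : IsHecke p T) (hL : 3 ≤ L) {x : H L →L[ℂ] H L}
    (hx : x ∈ (Set.range T).centralizer.centralizer) (hxh : x * ∑ s, T s = (∑ s, T s) * x)
    {v w : W L} (h : len v = len w) : x (δ 1) v = x (δ 1) w := by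
  obtain ⟨R, hR⟩ := hT.exists_isRightHecke
  have hR' : ∀ t, R t ∈ (Set.range T).centralizer := by
    rintro t _ ⟨s, rfl⟩
    exact hT.commute hR s t
  have h1 : (∑ s, T s) (δ 1) = (∑ s, R s) (δ 1) := by
    simp [hT _ _, hR _ _, RD_iff_LD_inv, not_LD_one]
  have h2 : (∑ s, R s) * x = x * ∑ s, R s := by
    rw [Finset.sum_mul, Finset.mul_sum]
    exact Finset.sum_congr rfl fun s _ => hx _ (hR' s)
  have h3 : (∑ s, T s) (x (δ 1)) = (∑ s, R s) (x (δ 1)) := by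
    rw [← mul_apply_eq_comp, ← mul_apply_eq_comp, ← hxh, h2,
      mul_apply_eq_comp, mul_apply_eq_comp, h1]
  refine eq_of_len_eq (f := x (δ 1)) hL (fun w => ?_) ?_ h
  · by_cases hw : w = 1
    · simp [hw]
    · have := congrArg (fun y : H L => y w) h3
      simpa only [hT.sum_apply _ hw, hR.sum_apply _ hw, add_left_inj] using this
  · simpa using (lp.memℓp (x (δ 1))).summable (by norm_num)

/-! ### Approximation by polynomials in `h` -/

/-- The indicator function of the sphere of radius `n`. -/
def χ (L n : ℕ) : H L := ∑ w ∈ sphere L n, δ w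

lemma χ_apply (n : ℕ) (w : W L) : χ L n w = if len w = n then 1 else 0 := by
  classical
  rw [← evalL_apply, χ, map_sum]
  simp [δ_apply]

lemma sum_ite_len (m : ℕ) {w : W L} (hw : w ≠ 1) :
    ∑ s, (if len (σ s * w) = m then (1 : ℂ) else 0) =
      (if len w = m + 1 then 1 else 0) + ((L - 1 : ℕ) : ℂ) * (if len w + 1 = m then 1 else 0) := by
  rw [← down_add_up (fun v => if len v = m then (1 : ℂ) else 0)]
  congr 1
  · obtain ⟨s, hs, h⟩ := filter_LD hw
    have := len_σ_mul_of_LD hs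
    rw [down, h, Finset.sum_singleton]
    simp only [← this, add_left_inj]
  · rw [up, ← card_filter_not_LD hw, ← nsmul_eq_mul, ← Finset.sum_const]
    refine Finset.sum_congr rfl fun s hs => ?_
    rw [len_σ_mul_of_not_LD (Finset.mem_filter.1 hs).2]

lemma IsHecke.sum_χ_zero (hT : IsHecke p T) : (∑ s, T s) (χ L 0) = χ L 1 := by
  ext w
  by_cases hw : w = 1
  · subst hw
    rw [hT.sum_apply_one]
    have : ∀ s : Fin L, len (σ s) = 1 := (cs L).length_simple
    simp [χ_apply, this]
  · rw [hT.sum_apply _ hw]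
    simp [χ_apply, sum_ite_len 0 hw, hw]

lemma IsHecke.sum_χ_succ (hT : IsHecke p T) (n : ℕ) : ∃ c : ℂ,
    (∑ s, T s) (χ L (n + 1)) = χ L (n + 2) + c • χ L n + (p : ℂ) • χ L (n + 1) := by
  have h1 : ∀ s : Fin L, len (σ s) = 1 := (cs L).length_simple
  refine ⟨if n = 0 then L else (L - 1 : ℕ), ?_⟩
  ext w
  change _ = χ L (n + 2) w + _ * χ L n w + _ * χ L (n + 1) w
  by_cases hw : w = 1
  · subst hw
    rw [hT.sum_apply_one]
    rcases n with _ | n <;> simp [χ_apply, h1]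
  · rw [hT.sum_apply _ hw]
    simp only [χ_apply, sum_ite_len (n + 1) hw, add_left_inj]
    rcases n with _ | n
    · simp [len_eq_zero, hw]
    · simp

lemma IsHecke.exists_χ_eq (hT : IsHecke p T) (n : ℕ) :
    ∃ P ∈ Algebra.adjoin ℂ {∑ s, T s}, P (δ 1) = χ L n := by
  have hh : ∑ s, T s ∈ Algebra.adjoin ℂ {∑ s, T s} := Algebra.subset_adjoin rfl
  have h0 : χ L 0 = δ 1 := by
    classical
    ext w
    simp [χ_apply, δ_apply]
  suffices ∀ n, (∃ P ∈ Algebra.adjoin ℂ {∑ s, T s}, P (δ 1) = χ L n) ∧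
      ∃ P ∈ Algebra.adjoin ℂ {∑ s, T s}, P (δ 1) = χ L (n + 1) from (this n).1
  intro n
  induction n with
  | zero => exact ⟨⟨1, one_mem _, h0.symm⟩, _, hh, by rw [← h0, hT.sum_χ_zero]⟩
  | succ n ih =>
    obtain ⟨⟨P, hP, hP'⟩, Q, hQ, hQ'⟩ := ih
    obtain ⟨c, hc⟩ := hT.sum_χ_succ n
    refine ⟨⟨Q, hQ, hQ'⟩, (∑ s, T s) * Q - c • P - (p : ℂ) • Q, ?_, ?_⟩
    · exact sub_mem (sub_mem (mul_mem hh hQ) (Subalgebra.smul_mem _ hP _))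
        (Subalgebra.smul_mem _ hQ _)
    · simp only [sub_apply, mul_apply_eq_comp,
        smul_apply, hP', hQ', hc]
      abel

lemma IsHecke.exists_norm_sub_lt (hT : IsHecke p T) {ξ : H L}
    (hξ : ∀ v w, len v = len w → ξ v = ξ w) {ε : ℝ} (hε : 0 < ε) :
    ∃ P ∈ Algebra.adjoin ℂ {∑ s, T s}, ‖ξ - P (δ 1)‖ < ε := by
  let K : Submodule ℂ (H L) := (Subalgebra.toSubmodule (Algebra.adjoin ℂ {∑ s, T s})).map
    (ContinuousLinearMap.apply ℂ (H L) (δ 1 : H L)).toLinearMap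
  have hsum : ∀ n, ∑ w ∈ sphere L n, ξ w • (δ w : H L) ∈ K := by
    intro n
    rcases (sphere L n).eq_empty_or_nonempty with h | ⟨v, hv⟩
    · simp [h]
    · have : ∑ w ∈ sphere L n, ξ w • (δ w : H L) = ξ v • χ L n := by
        rw [χ, Finset.smul_sum]
        refine Finset.sum_congr rfl fun w hw => ?_
        rw [hξ w v]
        rw [mem_sphere.1 hw, mem_sphere.1 hv]
      rw [this]
      obtain ⟨P, hP, hP'⟩ := hT.exists_χ_eq n
      exact K.smul_mem _ ⟨P, hP, hP'⟩
  have hmem : ξ ∈ closure (K : Set (H L)) :=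
    mem_closure_of_tendsto (hasSum_sum_sphere (hasSum_δ ξ))
      (Filter.Eventually.of_forall fun s => K.sum_mem fun n _ => hsum n)
  obtain ⟨_, ⟨P, hP, rfl⟩, hlt⟩ := Metric.mem_closure_iff.1 hmem ε hε
  exact ⟨P, hP, by rwa [dist_eq_norm] at hlt⟩

/-- Every basis vector is the image of `δ 1` under an operator in the commutant. -/
lemma IsHecke.exists_mem_centralizer (hT : IsHecke p T) (w : W L) :
    ∃ r ∈ (Set.range T).centralizer, r (δ 1) = δ w := by
  obtain ⟨R, hR⟩ := hT.exists_isRightHecke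
  have hR' : ∀ t, R t ∈ (Set.range T).centralizer := by
    rintro t _ ⟨s, rfl⟩
    exact hT.commute hR s t
  refine (cs L).simple_induction_right
    (p := fun w => ∃ r ∈ (Set.range T).centralizer, r (δ 1) = δ w) w
    ⟨1, Set.one_mem_centralizer, rfl⟩ ?_
  rintro w t ⟨r, hr, hr'⟩
  change ∃ r ∈ (Set.range T).centralizer, r (δ 1) = δ (w * σ t)
  refine ⟨R t * r - (if RD t w then (p : ℂ) else 0) • r, ?_, ?_⟩
  · exact (Subalgebra.centralizer ℂ (Set.range T)).sub_mem
      (Set.mul_mem_centralizer (hR' t) hr) ((Subalgebra.centralizer ℂ _).smul_mem hr _)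
  · rw [sub_apply, mul_apply_eq_comp, smul_apply, hr', hR t w, add_sub_cancel_right]

lemma IsHecke.mul_comm_of_isSelfAdjoint (hT : IsHecke p T) (hL : 3 ≤ L) {x : H L →L[ℂ] H L}
    (hx : x ∈ (Set.range T).centralizer.centralizer) (hxh : x * ∑ s, T s = (∑ s, T s) * x)
    (hxs : IsSelfAdjoint x) {y : H L →L[ℂ] H L} (hy : (∑ s, T s) * y = y * ∑ s, T s) :
    x * y = y * x := by
  set h := ∑ s, T s with hh
  have hhs : IsSelfAdjoint h := isSelfAdjoint_sum _ fun s _ => hT.isSelfAdjoint s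
  have hadj : ∀ P ∈ Algebra.adjoin ℂ {h}, ∀ c, c * h = h * c → c * P = P * c := by
    intro P hP c hc
    have : Algebra.adjoin ℂ {h} ≤ Subalgebra.centralizer ℂ {c} := by
      refine Algebra.adjoin_le ?_
      rintro _ rfl _ rfl
      exact hc
    exact this hP c rfl
  refine clm_ext fun w => ?_
  rw [← sub_eq_zero, ← sub_apply]
  ext v
  rw [← inner_δ_left, lp.coeFn_zero, Pi.zero_apply, ← norm_eq_zero]
  obtain ⟨rv, hrv, hrv'⟩ := hT.exists_mem_centralizer v
  obtain ⟨rw', hrw, hrw'⟩ := hT.exists_mem_centralizer w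
  set C : ℝ := ‖rv‖ * ‖y (δ w)‖ + ‖y‖ * ‖rw'‖ with hC
  have hC0 : 0 ≤ C := by positivity
  have hbound : ∀ ε : ℝ, 0 < ε → ‖⟪δ v, (x * y - y * x) (δ w)⟫‖ ≤ C * ε := by
    intro ε hε
    obtain ⟨P, hP, hlt⟩ := hT.exists_norm_sub_lt (fun v w => hT.radial hL hx hxh) hε
    have hxP := hadj P hP x hxh
    have hPs : star P * h = h * star P := by
      have := congrArg star (hadj P hP h rfl)
      rwa [star_mul, star_mul, hhs.star_eq] at this
    have hnormal : IsStarNormal (x - P) := by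
      have h1 := congrArg star hxP
      rw [star_mul, star_mul, hxs.star_eq] at h1
      have h2 := hadj P hP _ hPs
      rw [isStarNormal_iff, star_sub, hxs.star_eq]
      exact .sub_left (.sub_right rfl hxP) (.sub_right h1 h2)
    have hz : ∀ r ∈ (Set.range T).centralizer, r * (x - P) = (x - P) * r := by
      intro r hr
      have hrh : r * h = h * r := by
        rw [hh, Finset.mul_sum, Finset.sum_mul]
        exact Finset.sum_congr rfl fun s _ => (hr _ ⟨s, rfl⟩).symm
      rw [mul_sub, sub_mul, hx r hr, hadj P hP r hrh]
    have hzδ : ∀ r ∈ (Set.range T).centralizer, ‖(x - P) (r (δ 1))‖ ≤ ‖r‖ * ε := by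
      intro r hr
      rw [← mul_apply_eq_comp, ← hz r hr, mul_apply_eq_comp]
      exact (r.le_opNorm _).trans (by rw [sub_apply]; gcongr)
    have hcomm : x * y - y * x = (x - P) * y - y * (x - P) := by
      rw [sub_mul, mul_sub, hadj P hP y hy.symm]
      abel
    rw [hcomm, sub_apply, mul_apply_eq_comp, mul_apply_eq_comp, inner_sub_right]
    refine (norm_sub_le _ _).trans ?_
    rw [hC, add_mul]
    refine add_le_add ?_ ?_
    · rw [← ContinuousLinearMap.adjoint_inner_left]
      refine (norm_inner_le_norm _ _).trans ?_
      rw [← ContinuousLinearMap.isStarNormal_iff_norm_eq_adjoint.1 hnormal, mul_right_comm, ← hrv']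
      gcongr
      exact hzδ rv hrv
    · refine (norm_inner_le_norm _ _).trans ?_
      have h1 : ‖(δ v : H L)‖ = 1 := by
        simp [δ]
      rw [h1, one_mul, mul_assoc, ← hrw']
      refine (y.le_opNorm _).trans ?_
      gcongr
      exact hzδ rw' hrw
  refine le_antisymm (le_of_forall_pos_le_add fun η hη => ?_) (norm_nonneg _)
  refine (hbound (η / (C + 1)) (by positivity)).trans ?_
  rw [zero_add, mul_div_assoc', div_le_iff₀ (by positivity)]
  nlinarith

/-- An element of the Hecke von Neumann algebra which commutes with `h` commutes with the whole
commutant of `h`. -/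
lemma IsHecke.mul_comm_of_mem (hT : IsHecke p T) (hL : 3 ≤ L) {x : H L →L[ℂ] H L}
    (hx : x ∈ (Set.range T).centralizer.centralizer) (hxh : x * ∑ s, T s = (∑ s, T s) * x)
    {y : H L →L[ℂ] H L} (hy : (∑ s, T s) * y = y * ∑ s, T s) :
    x * y = y * x := by
  have hhs : IsSelfAdjoint (∑ s, T s) := isSelfAdjoint_sum _ fun s _ => hT.isSelfAdjoint s
  have hTstar : ∀ a ∈ Set.range T, star a ∈ Set.range T := by
    rintro _ ⟨s, rfl⟩
    rw [(hT.isSelfAdjoint s).star_eq]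
    exact ⟨s, rfl⟩
  have hx' : star x ∈ (Set.range T).centralizer.centralizer :=
    Set.star_mem_centralizer' (fun a ha => Set.star_mem_centralizer' hTstar ha) hx
  have hxh' : star x * ∑ s, T s = (∑ s, T s) * star x := by
    have := congrArg star hxh
    rw [star_mul, star_mul, hhs.star_eq] at this
    exact this.symm
  let A := Subalgebra.centralizer ℂ (Set.range T).centralizer ⊓
    Subalgebra.centralizer ℂ {∑ s, T s}
  have hA : ∀ a ∈ A, IsSelfAdjoint a → a * y = y * a := fun a ha hs =>
    hT.mul_comm_of_isSelfAdjoint hL ha.1 (ha.2 _ rfl).symm hs hy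
  have hxA : x ∈ A := ⟨hx, by rintro _ rfl; exact hxh.symm⟩
  have hxA' : star x ∈ A := ⟨hx', by rintro _ rfl; exact hxh'.symm⟩
  have hre : ((realPart x : H L →L[ℂ] H L)) ∈ A := by
    rw [realPart_apply_coe, ← Complex.coe_smul]
    exact A.smul_mem (A.add_mem hxA hxA') _
  have him : ((imaginaryPart x : H L →L[ℂ] H L)) ∈ A := by
    rw [imaginaryPart_apply_coe, ← Complex.coe_smul]
    exact A.smul_mem (A.smul_mem (A.sub_mem hxA hxA') _) _
  rw [← realPart_add_I_smul_imaginaryPart x, add_mul, mul_add, smul_mul_assoc, mul_smul_comm,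
    hA _ hre (realPart x).2, hA _ him (imaginaryPart x).2]

end UCoxMasa

namespace UCoxMasa

theorem statement0
    (L : ℕ) (hL : 3 ≤ L) (q p : ℝ) (hq : 0 < q) (hq1 : q ≤ 1)
    (hp : p = (q - 1) / Real.sqrt q)
    (T : Fin L → H L →L[ℂ] H L)
    (hT : ∀ (s : Fin L) (w : W L),
      T s (δ w) =
        if len (σ s * w) < len w then δ (σ s * w) + (p : ℂ) • δ w else δ (σ s * w))
    (h : H L →L[ℂ] H L) (hh : h = ∑ s, T s) :
    ({x : H L →L[ℂ] H L |
        x ∈ (Set.range T).centralizer.centralizer ∧ x * h = h * x}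
      = ({h} : Set (H L →L[ℂ] H L)).centralizer.centralizer)
    ∧ (∀ a ∈ ({h} : Set (H L →L[ℂ] H L)).centralizer.centralizer,
        ∀ b ∈ ({h} : Set (H L →L[ℂ] H L)).centralizer.centralizer, a * b = b * a)
    ∧ ({h} : Set (H L →L[ℂ] H L)).centralizer.centralizer
        ⊆ (Set.range T).centralizer.centralizer
    ∧ (∀ x ∈ (Set.range T).centralizer.centralizer,
        (∀ b ∈ ({h} : Set (H L →L[ℂ] H L)).centralizer.centralizer, x * b = b * x) →
          x ∈ ({h} : Set (H L →L[ℂ] H L)).centralizer.centralizer) := by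
  have hT' : IsHecke p T := by
    intro s w
    rw [hT s w]
    by_cases h1 : LD s w
    · rw [if_pos h1]
      exact if_pos h1
    · rw [if_neg h1, zero_smul, add_zero]
      exact if_neg h1
  subst hh
  have hsub : (Set.range T).centralizer ⊆ ({∑ s, T s} : Set (H L →L[ℂ] H L)).centralizer := by
    rintro r hr _ rfl
    rw [Finset.mul_sum, Finset.sum_mul]
    exact Finset.sum_congr rfl fun s _ => hr _ ⟨s, rfl⟩
  have hmem : (∑ s, T s) ∈ ({∑ s, T s} : Set (H L →L[ℂ] H L)).centralizer := by
    rintro _ rfl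
    rfl
  have hmasa : ∀ x ∈ (Set.range T).centralizer.centralizer,
      x * ∑ s, T s = (∑ s, T s) * x →
        x ∈ ({∑ s, T s} : Set (H L →L[ℂ] H L)).centralizer.centralizer :=
    fun x hx hxh y hy => (hT'.mul_comm_of_mem hL hx hxh (hy _ rfl)).symm
  refine ⟨?_, ?_, Set.centralizer_subset hsub, ?_⟩
  · refine Set.Subset.antisymm (fun x hx => hmasa x hx.1 hx.2) fun x hx => ?_
    exact ⟨Set.centralizer_subset hsub hx, (hx _ hmem).symm⟩
  · intro a ha b hb
    refine hb a ?_
    rintro _ rfl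
    exact ha _ hmem
  · intro x hx hxb
    refine hmasa x hx (hxb _ ?_)
    exact Set.subset_centralizer_centralizer rfl

end UCoxMasa
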